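/- Fix rewards r_DC > r_CC > r_DD > r_CD with 2r_CC > r_CD + r_DC, a discount 0 < γ < 1 with γ > (r_DC − r_CC)/(r_CC − r_DD), and δ ∈ (0,1). Consider the stochastic self-play ε-greedy Q-learning process with step size α and exploration ε, defined on the finite product probability space Ω = (Fin T → Bool × Bool) equipped with the product of Bernoulli(ε) measures, started from s₀ = (D,D) and an initial Q-table Q⁰ satisfying: Q⁰(s,D) > Q⁰(s,C) for every state s; r_DD/(1−γ) < Q⁰((D,D),C); Q⁰((D,D),C) < (γ·r_CC + r_DD)/(1−γ²) < Q⁰((C,C),C); Q⁰((D,D),D) < Q⁰((C,C),C); and Q⁰((C,C),C) < r_CC/(1−γ). Then there exist constants C > 0 (independent of γ, α, the rewards, and Q⁰) and C' > 0 (independent of α) and ε₀ ∈ (0,1/2) such that for every 0 < ε < ε₀ and every 0 < α ≤ C·log(1/ε)/log(1/δ), taking horizon T = ⌈C'/α⌉, the probability that there exists t ≤ T such that the greedy policy of Qᵗ is lose-shift or Pavlov is at least 1 − δ. -/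

import Mathlib

open scoped Classical

inductive Act | C | D
deriving DecidableEq

open Act

abbrev State := Act × Act

/-- The greedy action of a Q-table in a state. -/
noncomputable def greedy (Q : State → Act → ℝ) (s : State) : Act :=
  if Q s C > Q s D then C else D

/-- The other (exploratory) action. -/
def other : Act → Act
  | C => D
  | D => C

/-- Action taken by an agent with Q-table `Q` in state `s` given its exploration
coin: the greedy action if the coin is `false`, the other action otherwise. -/
noncomputable def act (Q : State → Act → ℝ) (s : State) (coin : Bool) : Act :=
  if coin then other (greedy Q s) else greedy Q s

/-- One step of stochastic self-play ε-greedy Q-learning: both agents share the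
table `Q`; agent 1 is in state `s1`, agent 2 in the swapped state; only the entry
`(s1, a1)` is updated. Returns the new table and agent 1's new state. -/
noncomputable def qstep (r : Act → Act → ℝ) (α γ : ℝ)
    (Q : State → Act → ℝ) (s1 : State) (coins : Bool × Bool) :
    (State → Act → ℝ) × State :=
  let a1 := act Q s1 coins.1
  let a2 := act Q (s1.2, s1.1) coins.2
  (fun p b =>
    if p = s1 ∧ b = a1 then
      Q s1 a1 + α * (r a1 a2 + γ * max (Q (a1, a2) C) (Q (a1, a2) D) - Q s1 a1)
    else Q p b,
   (a1, a2))

/-- The Q-learning trajectory driven by the exploration coins `ω`, started from the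
table `Q0` and the state (D, D). -/
noncomputable def traj (r : Act → Act → ℝ) (α γ : ℝ) (Q0 : State → Act → ℝ)
    (ω : ℕ → Bool × Bool) : ℕ → (State → Act → ℝ) × State
  | 0 => (Q0, (D, D))
  | t + 1 => qstep r α γ (traj r α γ Q0 ω t).1 (traj r α γ Q0 ω t).2 (ω t)

/-- The greedy policy of `Q` is lose-shift. -/
def isLoseShift (Q : State → Act → ℝ) : Prop :=
  Q (D, D) C > Q (D, D) D ∧ Q (C, C) D > Q (C, C) C ∧
  Q (C, D) D > Q (C, D) C ∧ Q (D, C) D > Q (D, C) C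

/-- The greedy policy of `Q` is Pavlov. -/
def isPavlov (Q : State → Act → ℝ) : Prop :=
  Q (D, D) C > Q (D, D) D ∧ Q (C, C) C > Q (C, C) D ∧
  Q (C, D) D > Q (C, D) C ∧ Q (D, C) D > Q (D, C) C

/-- Weight of one pair of independent Bernoulli(ε) exploration coins. -/
noncomputable def coinWeight (ε : ℝ) (c : Bool × Bool) : ℝ :=
  (if c.1 then ε else 1 - ε) * (if c.2 then ε else 1 - ε)

/-- Extend a finite coin sequence to ℕ. -/
def extendCoins {T : ℕ} (ω : Fin T → Bool × Bool) : ℕ → Bool × Bool :=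
  fun t => if h : t < T then ω ⟨t, h⟩ else (false, false)

/-- Number of steps before `t` with some exploration. -/
noncomputable def nExp (ω : ℕ → Bool × Bool) (t : ℕ) : ℝ :=
  ∑ s ∈ Finset.range t, if ω s = (false, false) then (0 : ℝ) else 1

lemma nExp_succ (ω : ℕ → Bool × Bool) (t : ℕ) :
    nExp ω (t + 1) = nExp ω t + if ω t = (false, false) then (0 : ℝ) else 1 := by
  simp [nExp, Finset.sum_range_succ]

lemma nExp_nonneg (ω : ℕ → Bool × Bool) (t : ℕ) : 0 ≤ nExp ω t := by
  unfold nExp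
  apply Finset.sum_nonneg
  intro s _
  split_ifs <;> norm_num

lemma nExp_mono (ω : ℕ → Bool × Bool) {s t : ℕ} (h : s ≤ t) : nExp ω s ≤ nExp ω t := by
  unfold nExp
  apply Finset.sum_le_sum_of_subset_of_nonneg
  · intro x hx
    simp only [Finset.mem_range] at *
    omega
  · intro s _ _
    split_ifs <;> norm_num

/-- A perturbed step changes every entry by at most `2 * M * α`. -/
lemma qstep_perturbed (r : Act → Act → ℝ) (α γ M : ℝ) (hγ : 0 < γ) (hα : 0 < α)
    (hα1 : α ≤ 1) (hr : ∀ a b, |r a b| ≤ (1 - γ) * M)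
    (Q : State → Act → ℝ) (s : State) (c : Bool × Bool) (hQ : ∀ p b, |Q p b| ≤ M)
    (p : State) (b : Act) :
    |(qstep r α γ Q s c).1 p b| ≤ M ∧ |(qstep r α γ Q s c).1 p b - Q p b| ≤ 2 * M * α := by
  have hM : 0 ≤ M := le_trans (abs_nonneg _) (hQ p b)
  simp only [qstep]
  generalize act Q s c.1 = a1
  generalize act Q (s.2, s.1) c.2 = a2
  split_ifs with h
  · obtain ⟨rfl, rfl⟩ := h
    have h1 := abs_le.1 (hr b a2)
    have h2 := abs_le.1 (hQ (b, a2) C)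
    have h3 := abs_le.1 (hQ (b, a2) D)
    have h4 := abs_le.1 (hQ p b)
    have hm1 : max (Q (b, a2) C) (Q (b, a2) D) ≤ M := max_le h2.2 h3.2
    have hm2 : -M ≤ max (Q (b, a2) C) (Q (b, a2) D) := le_trans h2.1 (le_max_left _ _)
    generalize max (Q (b, a2) C) (Q (b, a2) D) = m at *
    have hg1 : γ * m ≤ γ * M := mul_le_mul_of_nonneg_left hm1 hγ.le
    have hg2 : γ * (-M) ≤ γ * m := mul_le_mul_of_nonneg_left hm2 hγ.le
    have e1 : r b a2 + γ * m ≤ M := by linarith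
    have e2 : -M ≤ r b a2 + γ * m := by linarith
    generalize r b a2 + γ * m = y at *
    have k1 : α * y ≤ α * M := mul_le_mul_of_nonneg_left e1 hα.le
    have k2 : α * (-M) ≤ α * y := mul_le_mul_of_nonneg_left e2 hα.le
    have k3 : (1 - α) * Q p b ≤ (1 - α) * M :=
      mul_le_mul_of_nonneg_left h4.2 (by linarith)
    have k4 : (1 - α) * (-M) ≤ (1 - α) * Q p b :=
      mul_le_mul_of_nonneg_left h4.1 (by linarith)
    have k5 : α * Q p b ≤ α * M := mul_le_mul_of_nonneg_left h4.2 hα.le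
    have k6 : α * (-M) ≤ α * Q p b := mul_le_mul_of_nonneg_left h4.1 hα.le
    constructor <;> rw [abs_le] <;> constructor <;> linarith
  · refine ⟨hQ p b, ?_⟩
    simp
    positivity

lemma qstep_clean (r : Act → Act → ℝ) (α γ : ℝ) (Q : State → Act → ℝ)
    (hg : ∀ s, greedy Q s = D) (hd : Q (D, D) C ≤ Q (D, D) D) :
    (qstep r α γ Q (D, D) (false, false)).2 = (D, D) ∧
    (qstep r α γ Q (D, D) (false, false)).1 (D, D) D =
      Q (D, D) D + α * (r D D + γ * Q (D, D) D - Q (D, D) D) ∧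
    ∀ p b, ¬ (p = (D, D) ∧ b = D) →
      (qstep r α γ Q (D, D) (false, false)).1 p b = Q p b := by
  refine ⟨?_, ?_, ?_⟩
  · simp [qstep, act, hg]
  · simp [qstep, act, hg, max_eq_right hd]
  · intro p b h
    simp only [qstep, act, hg]
    simp [h]

lemma qstep_state (r : Act → Act → ℝ) (α γ : ℝ) (Q : State → Act → ℝ) (s : State)
    (hg : ∀ s, greedy Q s = D) : (qstep r α γ Q s (false, false)).2 = (D, D) := by
  simp [qstep, act, hg]

lemma det_core (r : Act → Act → ℝ) (α γ M κ ρ η : ℝ) (hγ : 0 < γ) (hγ1 : γ < 1) (hα : 0 < α)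
    (hκ : 0 < κ) (hM : 0 < M) (hr : ∀ a b, |r a b| ≤ (1 - γ) * M)
    (Q0 : State → Act → ℝ) (hQ0 : ∀ p b, |Q0 p b| ≤ M)
    (hgap : ∀ p, Q0 p D - Q0 p C > 2 * ρ)
    (hv : r D D / (1 - γ) + κ + ρ ≤ Q0 (D, D) C)
    (hηρ : 4 * M * η ≤ ρ)
    (ω : ℕ → Bool × Bool) (T : ℕ)
    (hN : ∀ t ≤ T, α * nExp ω t ≤ η) (hP : ∀ t ≤ T, 0 < nExp ω t → α ≤ 1)
    (hT : M - r D D / (1 - γ) + 2 * η * ((1 - γ) * κ + 2 * M) ≤ (1 - γ) * κ * (α * T)) :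
    ∃ t ≤ T, isLoseShift (traj r α γ Q0 ω t).1 := by
  by_contra hcon
  push Not at hcon
  set v := r D D / (1 - γ) with hvdef
  have h1γ : 0 < 1 - γ := by linarith
  have hrv : r D D = (1 - γ) * v := by rw [hvdef]; field_simp
  -- consequences of the deviation bound
  have main : ∀ t ≤ T, ∀ k : ℝ, k ≤ 2 * nExp ω t →
      (∀ p b, ¬ (p = ((D, D) : State) ∧ b = D) →
        |(traj r α γ Q0 ω t).1 p b - Q0 p b| ≤ 2 * M * α * k) →
      (∀ s, greedy (traj r α γ Q0 ω t).1 s = D) ∧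
      (traj r α γ Q0 ω t).1 (D, D) C ≤ (traj r α γ Q0 ω t).1 (D, D) D ∧
      v + κ ≤ (traj r α γ Q0 ω t).1 (D, D) C := by
    intro t ht k hk hdev
    have hb : 2 * M * α * k ≤ ρ := by
      have h1 := hN t ht
      have : 2 * M * α * k ≤ 2 * M * α * (2 * nExp ω t) :=
        mul_le_mul_of_nonneg_left hk (by positivity)
      have h2 : 4 * M * (α * nExp ω t) ≤ 4 * M * η :=
        mul_le_mul_of_nonneg_left h1 (by positivity)
      linarith
    have hlt : ∀ p, p ≠ ((D, D) : State) →
        (traj r α γ Q0 ω t).1 p C < (traj r α γ Q0 ω t).1 p D := by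
      intro p hp
      have a1 := abs_le.1 (hdev p C (by simp))
      have a2 := abs_le.1 (hdev p D (by simp [hp]))
      have := hgap p
      linarith
    have hnot : (traj r α γ Q0 ω t).1 (D, D) C ≤ (traj r α γ Q0 ω t).1 (D, D) D := by
      by_contra hlt'
      push Not at hlt'
      exact hcon t ht ⟨hlt', hlt _ (by simp), hlt _ (by simp), hlt _ (by simp)⟩
    refine ⟨?_, hnot, ?_⟩
    · intro s
      unfold greedy
      rw [if_neg]
      by_cases hs : s = (D, D)
      · subst hs
        exact not_lt.2 hnot
      · exact not_lt.2 (hlt s hs).le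
    · have a1 := abs_le.1 (hdev (D, D) C (by simp))
      linarith
  have inv : ∀ t ≤ T, ∃ k : ℝ, 0 ≤ k ∧
      k + (if (traj r α γ Q0 ω t).2 = (D, D) then (0 : ℝ) else 1) ≤ 2 * nExp ω t ∧
      (∀ p b, |(traj r α γ Q0 ω t).1 p b| ≤ M) ∧
      (∀ p b, ¬ (p = ((D, D) : State) ∧ b = D) →
        |(traj r α γ Q0 ω t).1 p b - Q0 p b| ≤ 2 * M * α * k) ∧
      (traj r α γ Q0 ω t).1 (D, D) D ≤
        Q0 (D, D) D - α * (1 - γ) * κ * (t - k) + 2 * M * α * k := by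
    intro t
    induction t with
    | zero =>
      intro _
      refine ⟨0, le_rfl, ?_, ?_, ?_, ?_⟩ <;> simp [traj, nExp, hQ0]
    | succ t ih =>
      intro ht
      obtain ⟨k, hk0, hk, hB, hdev, hx⟩ := ih (by omega)
      have hk' : k ≤ 2 * nExp ω t := by
        split_ifs at hk <;> linarith
      obtain ⟨hg, hd, hvk⟩ := main t (by omega) k hk' hdev
      have hsucc := nExp_succ ω t
      have main' := main (t + 1) ht
      rw [traj] at main' ⊢
      generalize traj r α γ Q0 ω t = Z at *
      obtain ⟨Q, s⟩ := Z
      simp only at *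
      by_cases hclean : s = (D, D) ∧ ω t = (false, false)
      · obtain ⟨rfl, hω⟩ := hclean
        rw [hω] at main' ⊢
        rw [hω] at hsucc
        obtain ⟨c1, c2, c3⟩ := qstep_clean r α γ Q hg hd
        have hdev' : ∀ p b, ¬ (p = ((D, D) : State) ∧ b = D) →
          |(qstep r α γ Q (D, D) (false, false)).1 p b - Q0 p b| ≤ 2 * M * α * k := by
          intro p b h
          rw [c3 p b h]
          exact hdev p b h
        simp only [if_true, add_zero] at hk hsucc
        obtain ⟨-, m2, -⟩ := main' k (by linarith) hdev'
        have hdec : (qstep r α γ Q (D, D) (false, false)).1 (D, D) D ≤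
            Q (D, D) D - α * (1 - γ) * κ := by
          rw [c2, hrv]
          have : 0 ≤ (α * (1 - γ)) * (Q (D, D) D - v - κ) :=
            mul_nonneg (by positivity) (by linarith)
          nlinarith
        have hpos : 0 < α * (1 - γ) * κ := by positivity
        refine ⟨k, hk0, ?_, ?_, hdev', ?_⟩
        · rw [c1]
          simp only [if_true]
          linarith
        · intro p b
          by_cases h : p = (D, D) ∧ b = D
          · obtain ⟨rfl, rfl⟩ := h
            rw [c3 _ C (by simp)] at m2
            have b1 := abs_le.1 (hB (D, D) D)
            have b2 := abs_le.1 (hB (D, D) C)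
            rw [abs_le]
            constructor <;> linarith
          · rw [c3 p b h]
            exact hB p b
        · push_cast
          linarith
      · have hpos : 0 < nExp ω (t + 1) := by
          have h0 := nExp_nonneg ω t
          by_cases hω : ω t = (false, false)
          · have hs : s ≠ (D, D) := fun h => hclean ⟨h, hω⟩
            rw [if_neg hs] at hk
            rw [if_pos hω] at hsucc
            linarith
          · rw [if_neg hω] at hsucc
            linarith
        have hα1 := hP (t + 1) ht hpos
        have hst := qstep_perturbed r α γ M hγ hα hα1 hr Q s (ω t) hB
        refine ⟨k + 1, by linarith, ?_, fun p b => (hst p b).1, ?_, ?_⟩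
        · by_cases hω : ω t = (false, false)
          · have hs : s ≠ (D, D) := fun h => hclean ⟨h, hω⟩
            rw [if_neg hs] at hk
            rw [if_pos hω] at hsucc
            rw [hω, qstep_state r α γ Q s hg, if_pos rfl]
            linarith
          · rw [if_neg hω] at hsucc
            split_ifs <;> linarith
        · intro p b h
          have a1 := abs_le.1 (hst p b).2
          have a2 := abs_le.1 (hdev p b h)
          rw [abs_le]
          constructor <;> linarith
        · have a1 := abs_le.1 (hst (D, D) D).2
          push_cast
          linarith
  obtain ⟨k, hk0, hk, hB, hdev, hx⟩ := inv T le_rfl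
  have hk' : k ≤ 2 * nExp ω T := by
    split_ifs at hk <;> linarith
  obtain ⟨-, hd, hvk⟩ := main T le_rfl k hk' hdev
  have hQD := abs_le.1 (hQ0 (D, D) D)
  have hαk : α * k ≤ 2 * η := by
    have := hN T le_rfl
    have := mul_le_mul_of_nonneg_left hk' hα.le
    linarith
  have : α * k * ((1 - γ) * κ + 2 * M) ≤ 2 * η * ((1 - γ) * κ + 2 * M) :=
    mul_le_mul_of_nonneg_right hαk (by positivity)
  linarith

lemma coinWeight_sum (ε : ℝ) : ∑ c : Bool × Bool, coinWeight ε c = 1 := by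
  simp [Fintype.sum_prod_type, coinWeight]
  ring

lemma coinWeight_nonneg (ε : ℝ) (h0 : 0 ≤ ε) (h1 : ε ≤ 1) (c : Bool × Bool) :
    0 ≤ coinWeight ε c := by
  unfold coinWeight
  apply mul_nonneg <;> split_ifs <;> linarith

lemma weight_sum (ε : ℝ) (T : ℕ) :
    ∑ ω : Fin T → Bool × Bool, ∏ t, coinWeight ε (ω t) = 1 := by
  rw [← Fintype.prod_sum (fun (_ : Fin T) c => coinWeight ε c)]
  simp [coinWeight_sum]

lemma weight_marginal (ε : ℝ) (T : ℕ) (t : Fin T) :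
    ∑ ω : Fin T → Bool × Bool, (∏ s, coinWeight ε (ω s)) *
      (if ω t = (false, false) then (0 : ℝ) else 1) = 2 * ε - ε ^ 2 := by
  have h : ∀ ω : Fin T → Bool × Bool, (∏ s, coinWeight ε (ω s)) *
      (if ω t = (false, false) then (0 : ℝ) else 1) =
      ∏ s, (coinWeight ε (ω s) *
        (if s = t then (if ω s = (false, false) then (0 : ℝ) else 1) else 1)) := by
    intro ω
    rw [Finset.prod_mul_distrib]
    simp
  simp_rw [h]
  rw [← Fintype.prod_sum (fun (s : Fin T) c => coinWeight ε c *
        (if s = t then (if c = (false, false) then (0 : ℝ) else 1) else 1))]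
  rw [Finset.prod_eq_single t]
  · simp [Fintype.sum_prod_type, coinWeight]
    ring
  · intro s _ hs
    simp [hs, coinWeight_sum]
  · simp

lemma nExp_extend {T : ℕ} (ω : Fin T → Bool × Bool) :
    nExp (extendCoins ω) T = ∑ t : Fin T, if ω t = (false, false) then (0 : ℝ) else 1 := by
  unfold nExp
  rw [Finset.sum_range]
  simp [extendCoins]

lemma prob_bound (ε c : ℝ) (h0 : 0 ≤ ε) (h1 : ε ≤ 1) (hc : 0 ≤ c) (T : ℕ)
    (f : (Fin T → Bool × Bool) → ℝ)
    (hf : ∀ ω, 1 - c * nExp (extendCoins ω) T ≤ f ω) :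
    1 - c * (2 * ε * T) ≤ ∑ ω : Fin T → Bool × Bool, (∏ t, coinWeight ε (ω t)) * f ω := by
  have hmean : ∑ ω : Fin T → Bool × Bool, (∏ t, coinWeight ε (ω t)) *
      nExp (extendCoins ω) T = T * (2 * ε - ε ^ 2) := by
    simp_rw [nExp_extend, Finset.mul_sum]
    rw [Finset.sum_comm]
    simp_rw [weight_marginal]
    simp
    ring
  calc 1 - c * (2 * ε * T) ≤ 1 - c * (T * (2 * ε - ε ^ 2)) := by
        have : 0 ≤ c * (T * ε ^ 2) := by positivity
        linarith
    _ = ∑ ω : Fin T → Bool × Bool, (∏ t, coinWeight ε (ω t)) *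
          (1 - c * nExp (extendCoins ω) T) := by
        rw [← hmean, ← weight_sum ε T, Finset.mul_sum, ← Finset.sum_sub_distrib]
        apply Finset.sum_congr rfl
        intro ω _
        rw [weight_sum]
        ring
    _ ≤ _ := by
        apply Finset.sum_le_sum
        intro ω _
        exact mul_le_mul_of_nonneg_left (hf ω)
          (Finset.prod_nonneg fun t _ => coinWeight_nonneg ε h0 h1 _)

lemma exists_bound (r : Act → Act → ℝ) (γ : ℝ) (hγ1 : γ < 1) (Q0 : State → Act → ℝ) :
    ∃ M > 0, (∀ a b, |r a b| ≤ (1 - γ) * M) ∧ ∀ p b, |Q0 p b| ≤ M := by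
  have h1γ : 0 < 1 - γ := by linarith
  refine ⟨1 + (|r C C| + |r C D| + |r D C| + |r D D|) / (1 - γ) +
    (|Q0 (C, C) C| + |Q0 (C, C) D| + |Q0 (C, D) C| + |Q0 (C, D) D| +
     |Q0 (D, C) C| + |Q0 (D, C) D| + |Q0 (D, D) C| + |Q0 (D, D) D|), by positivity, ?_, ?_⟩
  · intro a b
    have : |r a b| ≤ |r C C| + |r C D| + |r D C| + |r D D| := by
      have := abs_nonneg (r C C)
      have := abs_nonneg (r C D)
      have := abs_nonneg (r D C)
      have := abs_nonneg (r D D)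
      cases a <;> cases b <;> linarith
    rw [mul_add, mul_add, mul_div_cancel₀ _ h1γ.ne']
    refine le_trans (this.trans ?_) (le_add_of_nonneg_right (by positivity))
    linarith
  · intro p b
    have h0 : 0 ≤ (|r C C| + |r C D| + |r D C| + |r D D|) / (1 - γ) := by positivity
    have := fun p b => abs_nonneg (Q0 p b)
    have := this (C, C) C
    have := abs_nonneg (Q0 (C, C) D)
    have := abs_nonneg (Q0 (C, D) C)
    have := abs_nonneg (Q0 (C, D) D)
    have := abs_nonneg (Q0 (D, C) C)
    have := abs_nonneg (Q0 (D, C) D)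
    have := abs_nonneg (Q0 (D, D) C)
    have := abs_nonneg (Q0 (D, D) D)
    obtain ⟨a, a'⟩ := p
    cases a <;> cases a' <;> cases b <;> linarith

/-- stochastic self-play ε-greedy Q-learning started from an
optimistic always-defect initialization reaches a cooperative (lose-shift or Pavlov)
greedy policy within O(1/α) steps, with probability at least 1 − δ, provided ε and α
are small enough; the probability is the product-Bernoulli(ε) measure on
Ω = (Fin T → Bool × Bool). -/
theorem qlearning_colludes_whp :
    ∃ Cst > (0 : ℝ),
      ∀ (rCC rCD rDC rDD : ℝ) (r : Act → Act → ℝ),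
        r C C = rCC → r C D = rCD → r D C = rDC → r D D = rDD →
        rDC > rCC → rCC > rDD → rDD > rCD → 2 * rCC > rCD + rDC →
      ∀ γ : ℝ, 0 < γ → γ < 1 → γ > (rDC - rCC) / (rCC - rDD) →
      ∀ δ : ℝ, 0 < δ → δ < 1 →
      ∀ Q0 : State → Act → ℝ,
        (∀ p : State, Q0 p D > Q0 p C) →
        rDD / (1 - γ) < Q0 (D, D) C →
        Q0 (D, D) C < (γ * rCC + rDD) / (1 - γ ^ 2) →
        (γ * rCC + rDD) / (1 - γ ^ 2) < Q0 (C, C) C →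
        Q0 (D, D) D < Q0 (C, C) C →
        Q0 (C, C) C < rCC / (1 - γ) →
      ∃ Cst' > (0 : ℝ), ∃ ε₀ ∈ Set.Ioo (0 : ℝ) (1 / 2),
        ∀ ε : ℝ, 0 < ε → ε < ε₀ →
        ∀ α : ℝ, 0 < α → α ≤ Cst * Real.log (1 / ε) / Real.log (1 / δ) →
          (∑ ω : Fin ⌈Cst' / α⌉₊ → Bool × Bool,
              (∏ t : Fin ⌈Cst' / α⌉₊, coinWeight ε (ω t)) *
                (if ∃ t ≤ ⌈Cst' / α⌉₊,
                    isLoseShift (traj r α γ Q0 (extendCoins ω) t).1 ∨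
                    isPavlov (traj r α γ Q0 (extendCoins ω) t).1
                  then (1 : ℝ) else 0))
            ≥ 1 - δ := by
  refine ⟨1, one_pos, ?_⟩
  intro rCC rCD rDC rDD r _ _ _ hDD _ _ _ _ γ hγ hγ1 _ δ hδ hδ1 Q0 hD hlow _ _ _ _
  subst hDD
  obtain ⟨M, hM, hr, hQ0⟩ := exists_bound r γ hγ1 Q0
  have h1γ : 0 < 1 - γ := by linarith
  obtain ⟨ρ, hρ, hgap, hv⟩ : ∃ ρ > 0, (∀ p, Q0 p D - Q0 p C > 2 * ρ) ∧
      ρ ≤ (Q0 (D, D) C - r D D / (1 - γ)) / 2 := by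
    refine ⟨min (min (min ((Q0 (C, C) D - Q0 (C, C) C) / 3) ((Q0 (C, D) D - Q0 (C, D) C) / 3))
      (min ((Q0 (D, C) D - Q0 (D, C) C) / 3) ((Q0 (D, D) D - Q0 (D, D) C) / 3)))
      ((Q0 (D, D) C - r D D / (1 - γ)) / 2), ?_, ?_, min_le_right _ _⟩
    · have h1 := hD (C, C)
      have h2 := hD (C, D)
      have h3 := hD (D, C)
      have h4 := hD (D, D)
      simp only [gt_iff_lt, lt_min_iff]
      refine ⟨⟨⟨?_, ?_⟩, ?_, ?_⟩, ?_⟩ <;> linarith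
    · intro p
      have hp := hD p
      have : min (min (min ((Q0 (C, C) D - Q0 (C, C) C) / 3) ((Q0 (C, D) D - Q0 (C, D) C) / 3))
        (min ((Q0 (D, C) D - Q0 (D, C) C) / 3) ((Q0 (D, D) D - Q0 (D, D) C) / 3)))
        ((Q0 (D, D) C - r D D / (1 - γ)) / 2) ≤ (Q0 p D - Q0 p C) / 3 := by
        obtain ⟨a, b⟩ := p
        cases a <;> cases b <;> simp only [min_le_iff, le_refl, true_or, or_true]
      linarith
  obtain ⟨κ, hκ, hκv⟩ : ∃ κ > 0, r D D / (1 - γ) + κ + ρ ≤ Q0 (D, D) C :=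
    ⟨(Q0 (D, D) C - r D D / (1 - γ)) / 2, by linarith, by linarith⟩
  obtain ⟨η, hη, hη1, hηρ⟩ : ∃ η > 0, η < 1 ∧ 4 * M * η ≤ ρ := by
    refine ⟨min (1 / 2) (ρ / (4 * M)), by positivity, ?_, ?_⟩
    · exact lt_of_le_of_lt (min_le_left _ _) (by norm_num)
    · calc 4 * M * min (1 / 2) (ρ / (4 * M)) ≤ 4 * M * (ρ / (4 * M)) :=
            mul_le_mul_of_nonneg_left (min_le_right _ _) (by positivity)
        _ = ρ := by field_simp
  have hvM : r D D / (1 - γ) < M := by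
    have := abs_le.1 (hQ0 (D, D) C)
    linarith
  obtain ⟨K, hK, hKeq⟩ : ∃ K > 0, (1 - γ) * κ * K =
      M - r D D / (1 - γ) + 2 * η * ((1 - γ) * κ + 2 * M) := by
    refine ⟨(M - r D D / (1 - γ) + 2 * η * ((1 - γ) * κ + 2 * M)) / ((1 - γ) * κ), ?_, ?_⟩
    · apply div_pos _ (by positivity)
      have : 0 < 2 * η * ((1 - γ) * κ + 2 * M) := by positivity
      linarith
    · rw [mul_div_cancel₀]
      positivity
  refine ⟨K, hK, min (1 / 4) (δ * η / (2 * (K + 1))), ⟨by positivity, ?_⟩, ?_⟩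
  · exact lt_of_le_of_lt (min_le_left _ _) (by norm_num)
  intro ε hε hεlt α hα _
  have hε4 : ε < 1 / 4 := lt_of_lt_of_le hεlt (min_le_left _ _)
  have hεδ : ε < δ * η / (2 * (K + 1)) := lt_of_lt_of_le hεlt (min_le_right _ _)
  rw [lt_div_iff₀ (by positivity)] at hεδ
  have hTlow : K / α ≤ (⌈K / α⌉₊ : ℝ) := Nat.le_ceil _
  have hTup : (⌈K / α⌉₊ : ℝ) < K / α + 1 := Nat.ceil_lt_add_one (by positivity)
  generalize ⌈K / α⌉₊ = T at *
  have hαT : K ≤ α * T := by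
    rw [div_le_iff₀ hα] at hTlow
    linarith
  have hmpos : 0 < min α 1 := lt_min hα one_pos
  have hmT : min α 1 * T ≤ K + 1 := by
    have h1 : min α 1 * T ≤ min α 1 * (K / α + 1) :=
      mul_le_mul_of_nonneg_left hTup.le hmpos.le
    have h2 : min α 1 * (K / α) ≤ α * (K / α) :=
      mul_le_mul_of_nonneg_right (min_le_left _ _) (by positivity)
    rw [mul_div_cancel₀ _ hα.ne'] at h2
    have h3 : min α 1 ≤ 1 := min_le_right _ _
    linarith
  have hb := prob_bound ε (min α 1 / η) hε.le (by linarith) (by positivity) T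
    (fun ω => if ∃ t ≤ T,
                    isLoseShift (traj r α γ Q0 (extendCoins ω) t).1 ∨
                    isPavlov (traj r α γ Q0 (extendCoins ω) t).1
                  then (1 : ℝ) else 0) ?_
  · refine le_trans ?_ hb
    have : min α 1 / η * (2 * ε * T) ≤ δ := by
      rw [div_mul_eq_mul_div, div_le_iff₀ hη]
      have : (min α 1 * T) * (2 * ε) ≤ (K + 1) * (2 * ε) :=
        mul_le_mul_of_nonneg_right hmT (by positivity)
      linarith
    linarith
  · intro ω
    have hnn := nExp_nonneg (extendCoins ω) T
    by_cases hgood : min α 1 * nExp (extendCoins ω) T ≤ η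
    · have hcase : α ≤ 1 ∨ nExp (extendCoins ω) T = 0 := by
        by_cases h1 : α ≤ 1
        · exact Or.inl h1
        · right
          rw [min_eq_right (by linarith), one_mul, nExp_extend] at hgood
          have hlt := lt_of_le_of_lt hgood hη1
          rw [nExp_extend]
          apply Finset.sum_eq_zero
          intro t ht
          by_contra hne
          have hle := Finset.single_le_sum
            (f := fun t : Fin T => if ω t = (false, false) then (0 : ℝ) else 1)
            (fun i _ => by split_ifs <;> norm_num) ht
          split_ifs at hne hle
          · exact hne rfl
          · linarith
      have hex := det_core r α γ M κ ρ η hγ hγ1 hα hκ hM hr Q0 hQ0 hgap hκv hηρ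
        (extendCoins ω) T ?_ ?_ ?_
      · obtain ⟨t, ht, hls⟩ := hex
        rw [if_pos ⟨t, ht, Or.inl hls⟩]
        have : 0 ≤ min α 1 / η * nExp (extendCoins ω) T := by positivity
        linarith
      · intro t ht
        have hm := nExp_mono (extendCoins ω) ht
        have h1 : α * nExp (extendCoins ω) t ≤ α * nExp (extendCoins ω) T :=
          mul_le_mul_of_nonneg_left hm hα.le
        rcases hcase with h | h
        · rw [min_eq_left h] at hgood
          linarith
        · rw [h] at h1
          linarith
      · intro t ht hp
        have hm := nExp_mono (extendCoins ω) ht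
        rcases hcase with h | h
        · exact h
        · linarith
      · rw [← hKeq]
        exact mul_le_mul_of_nonneg_left hαT (by positivity)
    · have h1 : 1 ≤ min α 1 / η * nExp (extendCoins ω) T := by
        rw [div_mul_eq_mul_div, le_div_iff₀ hη]
        linarith
      have h2 : (0 : ℝ) ≤ if ∃ t ≤ T,
                    isLoseShift (traj r α γ Q0 (extendCoins ω) t).1 ∨
                    isPavlov (traj r α γ Q0 (extendCoins ω) t).1
                  then (1 : ℝ) else 0 := by
        split_ifs <;> norm_num
      linarith
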